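/- arXiv:2402.10154 — 2 statements merged into one kernel-verified Lean document; each statement's English description precedes it below -/
import Mathlib

section
/- Let d ≥ 1, and let u : [0,∞) × ℝ^d → ℝ be a globally defined real-valued bounded classical solution of ∂_t u = Δu + ζ(u) with bounded continuous real-valued initial datum g satisfying inf_x |g(x) − 1| > 0. Set I = inf_x g(x) and S = sup_x g(x), assume S < 1, and assume u(t,x) < 1 for all (t,x). Suppose n1 and n2 are positive integers such that I ∈ (−4n1, −4n1 + 4) and S ∈ (−4n2, −4n2 + 4). Then for every x ∈ ℝ^d: −4n1 + 2 ≤ liminf_{t→∞} u(t,x) ≤ limsup_{t→∞} u(t,x) ≤ −4n2 + 2. -/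
open MeasureTheory
open scoped ENNReal

noncomputable section

/-- A bounded classical solution of `∂ₜ u = Δu + F(u)` (real-valued) on `[0,T)`. -/
def IsHeatSolutionR (d : ℕ) (F : ℝ → ℝ) (T : ℝ≥0∞)
    (g : EuclideanSpace ℝ (Fin d) → ℝ) (u : ℝ → EuclideanSpace ℝ (Fin d) → ℝ) : Prop :=
  ContinuousOn (fun p : ℝ × EuclideanSpace ℝ (Fin d) => u p.1 p.2)
      {p | 0 ≤ p.1 ∧ ENNReal.ofReal p.1 < T} ∧
  (∀ x, u 0 x = g x) ∧
  (∀ t' : ℝ, ENNReal.ofReal t' < T → ∃ C : ℝ, ∀ t x, 0 ≤ t → t ≤ t' → |u t x| ≤ C) ∧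
  ∃ (ut : ℝ → EuclideanSpace ℝ (Fin d) → ℝ)
    (ux uxx : ℝ → EuclideanSpace ℝ (Fin d) → Fin d → ℝ),
    (∀ t x, 0 < t → ENNReal.ofReal t < T → HasDerivAt (fun τ => u τ x) (ut t x) t) ∧
    (∀ t x i, 0 < t → ENNReal.ofReal t < T →
      HasDerivAt (fun s : ℝ => u t (x + s • EuclideanSpace.single i (1:ℝ))) (ux t x i) 0) ∧
    (∀ t x i, 0 < t → ENNReal.ofReal t < T →
      HasDerivAt (fun s : ℝ => ux t (x + s • EuclideanSpace.single i (1:ℝ)) i) (uxx t x i) 0) ∧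
    ContinuousOn (fun p : ℝ × EuclideanSpace ℝ (Fin d) => ut p.1 p.2)
      {p | 0 < p.1 ∧ ENNReal.ofReal p.1 < T} ∧
    (∀ i, ContinuousOn (fun p : ℝ × EuclideanSpace ℝ (Fin d) => uxx p.1 p.2 i)
      {p | 0 < p.1 ∧ ENNReal.ofReal p.1 < T}) ∧
    (∀ t x, 0 < t → ENNReal.ofReal t < T → ut t x = (∑ i, uxx t x i) + F (u t x))

/-- The real value `ζ(x) = Re (riemannZeta x)` of the Riemann zeta function at a real point. -/
def zetaR (x : ℝ) : ℝ := (riemannZeta (x : ℂ)).re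

lemma zeta_re_pos_of_one_lt (s : ℝ) (hs : 1 < s) : 0 < (riemannZeta (s : ℂ)).re := by
  have h1 : 1 < (s : ℂ).re := by simpa using hs
  have hsm : Summable (fun n : ℕ => 1 / ((n : ℝ) ) ^ s) := Real.summable_one_div_nat_rpow.mpr hs
  have h2 : riemannZeta (s : ℂ) = ((∑' n : ℕ, 1 / (n : ℝ) ^ s : ℝ) : ℂ) := by
    rw [zeta_eq_tsum_one_div_nat_cpow h1, Complex.ofReal_tsum]
    congr 1
    ext n
    push_cast
    rw [Complex.ofReal_cpow (by positivity)]
    simp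
  rw [h2, Complex.ofReal_re]
  refine hsm.tsum_pos (fun n => by positivity) 1 (by simp)

lemma zetaR_neg_formula (y : ℝ) (hy : y < 0) :
    ∃ c : ℝ, 0 < c ∧ zetaR y = c * Real.sin (Real.pi * y / 2) := by
  have hs : 1 < 1 - y := by linarith
  have hz := zeta_re_pos_of_one_lt (1 - y) hs
  have hG : 0 < Real.Gamma (1 - y) := Real.Gamma_pos_of_pos (by linarith)
  have hfe := riemannZeta_one_sub (s := ((1 - y : ℝ) : ℂ))
    (by
      intro n h
      have := congrArg Complex.re h
      simp at this
      have h0 : (0 : ℝ) ≤ n := n.cast_nonneg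
      linarith)
    (by
      intro h
      have := congrArg Complex.re h
      simp at this
      linarith)
  refine ⟨2 * (2 * Real.pi) ^ (-(1 - y)) * Real.Gamma (1 - y) * (riemannZeta ((1 - y : ℝ) : ℂ)).re,
    by positivity, ?_⟩
  have e1 : ((2 : ℂ) * (2 * (Real.pi : ℂ)) ^ (-((1 - y : ℝ) : ℂ)) * Complex.Gamma ((1 - y : ℝ) : ℂ)
      * Complex.cos ((Real.pi : ℂ) * ((1 - y : ℝ) : ℂ) / 2)) =
      ((2 * (2 * Real.pi) ^ (-(1 - y)) * Real.Gamma (1 - y) *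
        Real.cos (Real.pi * (1 - y) / 2) : ℝ) : ℂ) := by
    rw [Complex.ofReal_mul, Complex.ofReal_mul, Complex.ofReal_mul,
      Complex.ofReal_cpow (by positivity), Complex.Gamma_ofReal, Complex.ofReal_cos]
    push_cast
    rfl
  rw [e1] at hfe
  have e2 : (1 : ℂ) - ((1 - y : ℝ) : ℂ) = (y : ℂ) := by push_cast; ring
  rw [e2] at hfe
  unfold zetaR
  rw [hfe, Complex.re_ofReal_mul]
  have e3 : Real.cos (Real.pi * (1 - y) / 2) = Real.sin (Real.pi * y / 2) := by
    rw [← Real.cos_pi_div_two_sub]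
    congr 1
    ring
  rw [e3]
  ring

lemma zetaR_neg (n : ℕ) (hn : 0 < n) (y : ℝ) (h1 : -(4 * (n : ℝ)) + 2 < y)
    (h2 : y < -(4 * (n : ℝ)) + 4) : zetaR y < 0 := by
  have hn' : (1 : ℝ) ≤ n := by exact_mod_cast hn
  obtain ⟨c, hc, he⟩ := zetaR_neg_formula y (by linarith)
  rw [he]
  have hp := Real.pi_pos
  have : Real.sin (Real.pi * y / 2) < 0 := by
    have e : Real.sin (Real.pi * y / 2) = Real.sin (Real.pi * y / 2 + (n - 1 : ℕ) * (2 * Real.pi)) :=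
      (Real.sin_add_nat_mul_two_pi _ _).symm
    rw [e]
    push_cast [Nat.cast_sub hn]
    apply Real.sin_neg_of_neg_of_neg_pi_lt <;> nlinarith
  nlinarith

lemma zetaR_pos (n : ℕ) (hn : 0 < n) (y : ℝ) (h1 : -(4 * (n : ℝ)) < y)
    (h2 : y < -(4 * (n : ℝ)) + 2) : 0 < zetaR y := by
  have hn' : (1 : ℝ) ≤ n := by exact_mod_cast hn
  obtain ⟨c, hc, he⟩ := zetaR_neg_formula y (by linarith)
  rw [he]
  have hp := Real.pi_pos
  have : 0 < Real.sin (Real.pi * y / 2) := by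
    rw [← Real.sin_add_nat_mul_two_pi _ n]
    apply Real.sin_pos_of_pos_of_lt_pi <;> nlinarith
  positivity

lemma zetaR_continuousAt (y : ℝ) (hy : y < 1) : ContinuousAt zetaR y := by
  have h : (y : ℂ) ≠ 1 := by
    intro h
    have := congrArg Complex.re h
    simp at this
    linarith
  have h1 := (differentiableAt_riemannZeta h).continuousAt
  unfold zetaR
  exact Complex.continuous_re.continuousAt.comp
    (ContinuousAt.comp (f := fun y : ℝ => (y : ℂ)) h1 Complex.continuous_ofReal.continuousAt)

lemma zetaR_bddAbove (a : ℝ) : ∃ A, ∀ y, a ≤ y → y < 1 → zetaR y ≤ A := by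
  have ht : Filter.Tendsto (fun y : ℝ => (y - 1) * zetaR y) (nhdsWithin 1 (Set.Iio 1)) (nhds 1) := by
    have h0 : Filter.Tendsto (fun y : ℝ => (y : ℂ)) (nhdsWithin 1 (Set.Iio 1))
        (nhdsWithin 1 {1}ᶜ) := by
      apply tendsto_nhdsWithin_iff.mpr
      constructor
      · have := (Complex.continuous_ofReal.tendsto 1)
        rw [Complex.ofReal_one] at this
        exact this.mono_left nhdsWithin_le_nhds
      · filter_upwards [self_mem_nhdsWithin] with y hy
        have hy' : y ≠ 1 := ne_of_lt hy
        simpa using (by exact_mod_cast hy' : (y : ℂ) ≠ 1)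
    have h1 := (Complex.continuous_re.tendsto 1).comp (riemannZeta_residue_one.comp h0)
    refine h1.congr (fun y => ?_)
    simp only [Function.comp, zetaR]
    rw [show (y : ℂ) - 1 = ((y - 1 : ℝ) : ℂ) by push_cast; rfl, Complex.re_ofReal_mul]
  have hev : ∀ᶠ y in nhdsWithin (1 : ℝ) (Set.Iio 1), 0 < (y - 1) * zetaR y :=
    ht.eventually (lt_mem_nhds one_pos)
  obtain ⟨b, hb, hb2⟩ := (mem_nhdsLT_iff_exists_Ioo_subset).mp hev
  have hb1 : b < 1 := hb
  have hc : ContinuousOn zetaR (Set.Icc a b) := fun y hy =>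
    (zetaR_continuousAt y (lt_of_le_of_lt hy.2 hb1)).continuousWithinAt
  obtain ⟨A, hA⟩ := isCompact_Icc.bddAbove_image hc
  refine ⟨max A 0, fun y hy hy1 => ?_⟩
  by_cases hyb : y ≤ b
  · exact le_max_of_le_left (hA ⟨y, ⟨hy, hyb⟩, rfl⟩)
  · have h := hb2 (show y ∈ Set.Ioo b 1 from ⟨not_le.mp hyb, hy1⟩)
    simp only [Set.mem_ofPred_eq] at h
    apply le_max_of_le_right
    by_contra hcon
    push Not at hcon
    nlinarith

lemma second_deriv_nonpos {h h' : ℝ → ℝ} {h'' : ℝ} (hd : ∀ s, HasDerivAt h (h' s) s)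
    (hd' : HasDerivAt h' h'' 0) (hmax : IsLocalMax h 0) : h'' ≤ 0 := by
  by_contra hcon
  push Not at hcon
  have e1 : deriv h = h' := funext fun s => (hd s).deriv
  have hmin : IsLocalMin h 0 := by
    apply isLocalMin_of_deriv_deriv_pos
    · rw [e1, hd'.deriv]; exact hcon
    · exact hmax.deriv_eq_zero
    · exact (hd 0).continuousAt
  have hconst : h =ᶠ[nhds 0] fun _ => h 0 := by
    filter_upwards [hmax, hmin] with s h1 h2
    exact le_antisymm h1 h2
  have h3 : deriv h =ᶠ[nhds 0] fun _ => 0 := by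
    have := hconst.deriv
    simpa using this
  have h4 := h3.deriv_eq
  rw [e1, hd'.deriv] at h4
  simp at h4
  linarith

lemma second_deriv_le {f f' : ℝ → ℝ} {f'' c b k : ℝ} (hf : ∀ s, HasDerivAt f (f' s) s)
    (hf' : HasDerivAt f' f'' 0)
    (hmax : ∀ s, f s - c * (k + 2 * s * b + s ^ 2) ≤ f 0 - c * k) : f'' ≤ 2 * c := by
  have hd : ∀ s, HasDerivAt (fun s => f s - c * (k + 2 * s * b + s ^ 2))
      (f' s - c * (2 * b + 2 * s)) s := by
    intro s
    have h1 : HasDerivAt (fun s : ℝ => k + 2 * s * b + s ^ 2) (2 * b + 2 * s) s := by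
      have := ((((hasDerivAt_id s).const_mul 2).mul_const b).const_add k).add ((hasDerivAt_id s).pow 2)
      exact this.congr_deriv (by simp)
    exact (hf s).sub (h1.const_mul c)
  have hd' : HasDerivAt (fun s => f' s - c * (2 * b + 2 * s)) (f'' - c * 2) 0 := by
    have h1 : HasDerivAt (fun s : ℝ => 2 * b + 2 * s) 2 0 := by
      have := ((hasDerivAt_id (0 : ℝ)).const_mul 2).const_add (2 * b)
      exact this.congr_deriv (by simp)
    exact hf'.sub (h1.const_mul c)
  have := second_deriv_nonpos hd hd' (Filter.Eventually.of_forall fun s => by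
    have := hmax s
    simpa using this)
  linarith

/-- One-sided first-order condition at a maximum on `[0, t]` attained at the right end. -/
lemma deriv_nonneg_of_max_left {f : ℝ → ℝ} {f' t : ℝ} (ht : 0 < t) (hf : HasDerivAt f f' t)
    (hmax : ∀ s, 0 ≤ s → s ≤ t → f s ≤ f t) : 0 ≤ f' := by
  have h1 := hf.hasDerivWithinAt (s := Set.Iio t)
  have h2 := hasDerivWithinAt_iff_tendsto_slope' (by simp) |>.mp h1
  refine ge_of_tendsto h2 ?_
  have : Set.Ioo 0 t ∈ nhdsWithin t (Set.Iio t) := Ioo_mem_nhdsLT ht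
  filter_upwards [this] with s hs
  rw [slope_def_field]
  have := hmax s hs.1.le hs.2.le
  apply div_nonneg_of_nonpos <;> linarith [hs.2]

lemma comparison {d : ℕ} (hd : 1 ≤ d) {F : ℝ → ℝ} {g : EuclideanSpace ℝ (Fin d) → ℝ}
    {u : ℝ → EuclideanSpace ℝ (Fin d) → ℝ} (hu : IsHeatSolutionR d F ⊤ g u)
    (v v' : ℝ → ℝ) (hv : ∀ t, HasDerivAt v (v' t) t) (hg : ∀ x, g x ≤ v 0)
    (T L : ℝ) (hL : 0 ≤ L)
    (hF : ∀ t x, 0 < t → t ≤ T → v t < u t x → F (u t x) ≤ v' t + L * (u t x - v t)) :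
    ∀ t x, 0 ≤ t → t ≤ T → u t x ≤ v t := by
  obtain ⟨huc, hu0, hub, ut, ux, uxx, hut, hux, huxx, -, -, heq⟩ := hu
  have htop : ∀ t : ℝ, ENNReal.ofReal t < ⊤ := fun t => ENNReal.ofReal_lt_top
  intro t1 x1 ht1 ht1T
  set K : ℝ := L + 2 * d + 1 with hK
  have hvc : Continuous v := continuous_iff_continuousAt.mpr fun t => (hv t).continuousAt
  have hd' : (1 : ℝ) ≤ d := by exact_mod_cast hd
  suffices key : ∀ ε > 0, Real.exp (-K * t1) * (u t1 x1 - v t1) ≤ ε * (1 + ‖x1‖ ^ 2) by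
    have h0 : Real.exp (-K * t1) * (u t1 x1 - v t1) ≤ 0 := by
      apply le_of_forall_pos_le_add
      intro δ hδ
      have hp : 0 < 1 + ‖x1‖ ^ 2 := by positivity
      have := key (δ / (1 + ‖x1‖ ^ 2)) (by positivity)
      rw [div_mul_cancel₀ _ hp.ne'] at this
      linarith
    have he := Real.exp_pos (-K * t1)
    by_contra hcon
    push Not at hcon
    have : 0 < Real.exp (-K * t1) * (u t1 x1 - v t1) := mul_pos he (by linarith)
    linarith
  intro ε hε
  by_contra hcon
  push Not at hcon
  let φ : ℝ × EuclideanSpace ℝ (Fin d) → ℝ := fun p =>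
    Real.exp (-K * p.1) * (u p.1 p.2 - v p.1) - ε * (1 + ‖p.2‖ ^ 2)
  have hφ1 : 0 < φ (t1, x1) := by simp only [φ]; linarith
  obtain ⟨C, hC⟩ := hub T (htop T)
  obtain ⟨V, hV⟩ := (isCompact_Icc (a := (0 : ℝ)) (b := T)).exists_bound_of_continuousOn hvc.continuousOn
  have hCV : ∀ t x, 0 ≤ t → t ≤ T → Real.exp (-K * t) * (u t x - v t) ≤ C + V := by
    intro t x h0 hT
    have h1 := hC t x h0 hT
    have h2 := hV t ⟨h0, hT⟩
    rw [Real.norm_eq_abs] at h2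
    have h3 : |u t x - v t| ≤ C + V := (abs_sub _ _).trans (add_le_add h1 h2)
    have h4 : Real.exp (-K * t) ≤ 1 := by
      apply Real.exp_le_one_iff.mpr
      have : 0 ≤ K := by positivity
      nlinarith
    calc _ ≤ |Real.exp (-K * t) * (u t x - v t)| := le_abs_self _
      _ = Real.exp (-K * t) * |u t x - v t| := by rw [abs_mul, abs_of_pos (Real.exp_pos _)]
      _ ≤ 1 * |u t x - v t| := by gcongr
      _ ≤ C + V := by linarith
  have hfar : ∀ t x, 0 ≤ t → t ≤ T → (C + V) / ε < ‖x‖ ^ 2 → φ (t, x) < 0 := by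
    intro t x h0 hT hx
    have := hCV t x h0 hT
    rw [div_lt_iff₀ hε] at hx
    simp only [φ]
    nlinarith
  set R : ℝ := 1 + |(C + V) / ε| with hR
  have hRbig : ∀ x : EuclideanSpace ℝ (Fin d), R < ‖x‖ → (C + V) / ε < ‖x‖ ^ 2 := by
    intro x hx
    have := le_abs_self ((C + V) / ε)
    have := abs_nonneg ((C + V) / ε)
    nlinarith
  have hcomp : IsCompact (Set.Icc (0 : ℝ) T ×ˢ Metric.closedBall (0 : EuclideanSpace ℝ (Fin d)) R) :=
    isCompact_Icc.prod (isCompact_closedBall _ _)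
  have hφc : ContinuousOn φ (Set.Icc (0 : ℝ) T ×ˢ Metric.closedBall (0 : EuclideanSpace ℝ (Fin d)) R) := by
    have h1 : ContinuousOn (fun p : ℝ × EuclideanSpace ℝ (Fin d) => u p.1 p.2)
        (Set.Icc (0 : ℝ) T ×ˢ Metric.closedBall (0 : EuclideanSpace ℝ (Fin d)) R) :=
      huc.mono fun p hp => ⟨hp.1.1, htop _⟩
    have h2 : Continuous fun p : ℝ × EuclideanSpace ℝ (Fin d) => v p.1 := hvc.comp continuous_fst
    have h3 : Continuous fun p : ℝ × EuclideanSpace ℝ (Fin d) => Real.exp (-K * p.1) := by fun_prop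
    have h4 : Continuous fun p : ℝ × EuclideanSpace ℝ (Fin d) => ε * (1 + ‖p.2‖ ^ 2) := by fun_prop
    exact (h3.continuousOn.mul (h1.sub h2.continuousOn)).sub h4.continuousOn
  have hx1R : ‖x1‖ ≤ R := by
    by_contra h
    push Not at h
    have := hfar t1 x1 ht1 ht1T (hRbig x1 h)
    linarith
  have hmem1 : (t1, x1) ∈ (Set.Icc (0 : ℝ) T ×ˢ Metric.closedBall (0 : EuclideanSpace ℝ (Fin d)) R) :=
    ⟨⟨ht1, ht1T⟩, by simpa using hx1R⟩
  obtain ⟨⟨t0, x0⟩, hm0, hmax⟩ := hcomp.exists_isMaxOn ⟨_, hmem1⟩ hφc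
  have hpos : 0 < φ (t0, x0) := lt_of_lt_of_le hφ1 (hmax hmem1)
  have ht0T : t0 ≤ T := hm0.1.2
  have ht00 : 0 ≤ t0 := hm0.1.1
  have hglob : ∀ t x, 0 ≤ t → t ≤ T → φ (t, x) ≤ φ (t0, x0) := by
    intro t x h0 hT
    by_cases hx : ‖x‖ ≤ R
    · exact hmax (show (t, x) ∈ _ from ⟨⟨h0, hT⟩, by simpa using hx⟩)
    · push Not at hx
      have := hfar t x h0 hT (hRbig x hx)
      linarith
  have ht0 : 0 < t0 := by
    rcases ht00.lt_or_eq with h | h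
    · exact h
    · exfalso
      subst h
      simp only [φ] at hpos
      have h1 := hg x0
      rw [hu0 x0] at hpos
      simp at hpos
      have : 0 < ε * (1 + ‖x0‖ ^ 2) := by positivity
      linarith
  set E : ℝ := Real.exp (-K * t0) with hE
  have hEpos : 0 < E := Real.exp_pos _
  set w : ℝ := u t0 x0 - v t0 with hw
  have hwE : ε < E * w := by
    have h1 : 0 < E * w - ε * (1 + ‖x0‖ ^ 2) := hpos
    have : 0 ≤ ε * ‖x0‖ ^ 2 := by positivity
    linarith
  have hw0 : 0 < w := by
    by_contra h
    push Not at h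
    nlinarith
  -- time derivative
  have htime : 0 ≤ ut t0 x0 - v' t0 - K * w := by
    have h1 : HasDerivAt (fun t => Real.exp (-K * t)) (E * (-K)) t0 := by
      have := ((hasDerivAt_id t0).const_mul (-K)).exp
      exact this.congr_deriv (by simp [hE])
    have h2 := (h1.mul ((hut t0 x0 ht0 (htop _)).sub (hv t0))).sub_const (ε * (1 + ‖x0‖ ^ 2))
    have h3 := deriv_nonneg_of_max_left ht0 h2 (fun s hs hst => hglob s x0 hs (hst.trans ht0T))
    have h4 : 0 ≤ E * (ut t0 x0 - v' t0 - K * w) := by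
      refine h3.trans_eq ?_
      simp only [Pi.sub_apply]
      rw [← hw]
      ring
    exact nonneg_of_mul_nonneg_right h4 hEpos
  -- space derivatives
  have hspace : ∀ i, E * uxx t0 x0 i ≤ 2 * ε := by
    intro i
    set e : EuclideanSpace ℝ (Fin d) := EuclideanSpace.single i (1 : ℝ) with he
    have hen : ‖e‖ = 1 := by simp [he]
    have hnorm : ∀ s : ℝ, 1 + ‖x0 + s • e‖ ^ 2
        = (1 + ‖x0‖ ^ 2) + 2 * s * inner ℝ x0 e + s ^ 2 := by
      intro s
      rw [norm_add_sq_real, inner_smul_right, norm_smul, hen]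
      simp
      ring
    have h1 : ∀ s, HasDerivAt (fun s : ℝ => u t0 (x0 + s • e)) (ux t0 (x0 + s • e) i) s := by
      intro s
      have h := hux t0 (x0 + s • e) i ht0 (htop _)
      rw [← sub_self s] at h
      have h' := HasDerivAt.comp_sub_const s s h
      have hfun : (fun s : ℝ => u t0 (x0 + s • e)) =
          fun r : ℝ => u t0 (x0 + s • e + (r - s) • e) := by
        funext r
        rw [add_assoc, ← add_smul, add_sub_cancel]
      rw [hfun]
      exact h'
    refine second_deriv_le (f := fun s => E * (u t0 (x0 + s • e) - v t0))
      (f' := fun s => E * ux t0 (x0 + s • e) i) (b := inner ℝ x0 e) (k := 1 + ‖x0‖ ^ 2)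
      (fun s => ((h1 s).sub_const _).const_mul E)
      ((huxx t0 x0 i ht0 (htop _)).const_mul E) ?_
    intro s
    have h2 := hglob t0 (x0 + s • e) ht00 ht0T
    simp only [φ] at h2
    rw [hnorm] at h2
    simpa [hE] using h2
  have hsum : E * ∑ i, uxx t0 x0 i ≤ 2 * d * ε := by
    rw [Finset.mul_sum]
    calc _ ≤ ∑ i : Fin d, 2 * ε := Finset.sum_le_sum fun i _ => hspace i
      _ = 2 * d * ε := by simp; ring
  have hpde := heq t0 x0 ht0 (htop _)
  have hFF := hF t0 x0 ht0 ht0T (by linarith)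
  rw [← hw] at hFF
  have h5 : (K - L) * w ≤ ∑ i, uxx t0 x0 i := by
    rw [sub_mul]; linarith
  have h6 : E * ((K - L) * w) ≤ 2 * d * ε :=
    (mul_le_mul_of_nonneg_left h5 hEpos.le).trans hsum
  have h7 : K - L = 2 * d + 1 := by rw [hK]; ring
  rw [h7] at h6
  nlinarith

lemma eventually_le_of_stable {d : ℕ} (hd : 1 ≤ d) {F : ℝ → ℝ} {g : EuclideanSpace ℝ (Fin d) → ℝ}
    {u : ℝ → EuclideanSpace ℝ (Fin d) → ℝ} (hu : IsHeatSolutionR d F ⊤ g u)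
    (m S : ℝ) (hmS : m < S) (M : ℝ) (hSM : S < M) (hg : ∀ x, g x ≤ S)
    (hFc : ContinuousOn F (Set.Ioo m M)) (hFneg : ∀ y ∈ Set.Ioo m M, F y < 0)
    (hFb : ∀ T, ∃ A, ∀ t x, 0 ≤ t → t ≤ T → S ≤ u t x → F (u t x) ≤ A) :
    (∀ t x, 0 ≤ t → u t x ≤ S) ∧ ∀ η > m, ∀ x, ∀ᶠ t in Filter.atTop, u t x ≤ η := by
  have h1 : ∀ t x, 0 ≤ t → u t x ≤ S := by
    intro t x ht
    obtain ⟨A, hA⟩ := hFb t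
    have hMS : 0 < M - S := by linarith
    refine comparison hd hu (fun _ => S) (fun _ => 0) (fun t => hasDerivAt_const t S) hg t
      (max A 0 / (M - S)) (by positivity) ?_ t x ht le_rfl
    intro s y hs hst hlt
    have hL : 0 ≤ max A 0 / (M - S) := by positivity
    rw [zero_add]
    by_cases hc : u s y < M
    · have := hFneg _ ⟨hmS.trans hlt, hc⟩
      have : 0 ≤ max A 0 / (M - S) * (u s y - S) := mul_nonneg hL (by linarith)
      linarith
    · push Not at hc
      calc F (u s y) ≤ max A 0 := le_max_of_le_left (hA s y hs.le hst hlt.le)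
        _ = max A 0 / (M - S) * (M - S) := by field_simp
        _ ≤ _ := by gcongr
  refine ⟨h1, ?_⟩
  have main : ∀ η, m < η → η < S → ∃ c > 0, ∀ t x, 0 ≤ t →
      u t x ≤ η + (S - η) * Real.exp (-c * t) := by
    intro η hη hηS
    have hsub : Set.Icc η S ⊆ Set.Ioo m M := fun y hy => ⟨hη.trans_le hy.1, hy.2.trans_lt hSM⟩
    obtain ⟨y0, hy0, hmax⟩ := isCompact_Icc.exists_isMaxOn (Set.nonempty_Icc.mpr hηS.le)
      (hFc.mono hsub)
    have hc0 : 0 < -F y0 := by linarith [hFneg y0 (hsub hy0)]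
    have hSη : 0 < S - η := by linarith
    refine ⟨-F y0 / (S - η), by positivity, ?_⟩
    set c := -F y0 / (S - η) with hc
    have hcF : (S - η) * c = -F y0 := by rw [hc]; field_simp
    have hcpos : 0 < c := by positivity
    intro t x ht
    refine comparison hd hu (fun t => η + (S - η) * Real.exp (-c * t))
      (fun t => (S - η) * (Real.exp (-c * t) * (-c))) (fun t => ?_) (fun x => by simpa using hg x) t 0
      le_rfl ?_ t x ht le_rfl
    · have := (((hasDerivAt_id t).const_mul (-c)).exp.const_mul (S - η)).const_add η
      simpa using this
    · intro s y hs hst hlt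
      have he := Real.exp_pos (-c * s)
      have he1 : Real.exp (-c * s) ≤ 1 := by
        apply Real.exp_le_one_iff.mpr
        nlinarith
      have h2 : F (u s y) ≤ F y0 := by
        refine hmax (show u s y ∈ Set.Icc η S from ⟨?_, h1 s y hs.le⟩)
        have : 0 ≤ (S - η) * Real.exp (-c * s) := by positivity
        linarith
      have h3 : (S - η) * (Real.exp (-c * s) * (-c)) = F y0 * Real.exp (-c * s) := by
        linear_combination (-Real.exp (-c * s)) * hcF
      rw [h3]
      nlinarith
  intro η hη x
  set η' := (m + min η S) / 2 with hη'
  have hmin : m < min η S := lt_min hη hmS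
  have ha : m < η' := by linarith
  have hb : η' < min η S := by linarith
  obtain ⟨c, hc, hbd⟩ := main η' ha (hb.trans_le (min_le_right _ _))
  have hlim : Filter.Tendsto (fun t : ℝ => η' + (S - η') * Real.exp (-c * t)) Filter.atTop
      (nhds (η' + (S - η') * 0)) := by
    refine Filter.Tendsto.const_add _ (Filter.Tendsto.const_mul _ ?_)
    apply Real.tendsto_exp_atBot.comp
    exact Filter.tendsto_id.const_mul_atTop_of_neg (by linarith)
  have hη2 : η' + (S - η') * 0 < η := by
    have := min_le_left η S
    linarith
  filter_upwards [hlim.eventually (gt_mem_nhds hη2), Filter.eventually_ge_atTop 0] with t h2 h3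
  exact (hbd t x h3).trans h2.le

lemma neg_solution {d : ℕ} {F : ℝ → ℝ} {g : EuclideanSpace ℝ (Fin d) → ℝ}
    {u : ℝ → EuclideanSpace ℝ (Fin d) → ℝ} (hu : IsHeatSolutionR d F ⊤ g u) :
    IsHeatSolutionR d (fun y => -F (-y)) ⊤ (fun x => -g x) (fun t x => -u t x) := by
  obtain ⟨huc, hu0, hub, ut, ux, uxx, hut, hux, huxx, hutc, huxxc, heq⟩ := hu
  refine ⟨huc.neg, fun x => congrArg Neg.neg (hu0 x), fun t' ht' => ?_, fun t x => -ut t x,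
    fun t x i => -ux t x i, fun t x i => -uxx t x i, fun t x h h' => (hut t x h h').neg,
    fun t x i h h' => (hux t x i h h').neg, fun t x i h h' => (huxx t x i h h').neg,
    hutc.neg, fun i => (huxxc i).neg, fun t x h h' => ?_⟩
  · obtain ⟨C, hC⟩ := hub t' ht'
    exact ⟨C, fun t x h h' => by rw [abs_neg]; exact hC t x h h'⟩
  · simp only [neg_neg, Finset.sum_neg_distrib]
    rw [heq t x h h']
    ring

theorem stmt5 (d : ℕ) (hd : 1 ≤ d)
    (g : EuclideanSpace ℝ (Fin d) → ℝ) (hgc : Continuous g) (hgb : ∃ C, ∀ x, |g x| ≤ C)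
    (hgfar : 0 < ⨅ x, |g x - 1|)
    (u : ℝ → EuclideanSpace ℝ (Fin d) → ℝ)
    (hu : IsHeatSolutionR d (fun y => zetaR y) ⊤ g u)
    (I S : ℝ) (hI : I = ⨅ x, g x) (hS : S = ⨆ x, g x) (hSlt : S < 1)
    (hult : ∀ t x, 0 ≤ t → u t x < 1)
    (n1 n2 : ℕ) (hn1 : 0 < n1) (hn2 : 0 < n2)
    (hIn : I ∈ Set.Ioo (-(4 * (n1 : ℝ))) (-(4 * (n1 : ℝ)) + 4))
    (hSn : S ∈ Set.Ioo (-(4 * (n2 : ℝ))) (-(4 * (n2 : ℝ)) + 4)) :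
    ∀ x, -(4 * (n1 : ℝ)) + 2 ≤ Filter.liminf (fun t => u t x) Filter.atTop ∧
      Filter.liminf (fun t => u t x) Filter.atTop ≤ Filter.limsup (fun t => u t x) Filter.atTop ∧
      Filter.limsup (fun t => u t x) Filter.atTop ≤ -(4 * (n2 : ℝ)) + 2 := by
  obtain ⟨C, hC⟩ := hgb
  have hbA : BddAbove (Set.range g) := ⟨C, by rintro _ ⟨x, rfl⟩; exact (abs_le.mp (hC x)).2⟩
  have hbB : BddBelow (Set.range g) := ⟨-C, by rintro _ ⟨x, rfl⟩; exact (abs_le.mp (hC x)).1⟩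
  have hn1' : (1 : ℝ) ≤ n1 := by exact_mod_cast hn1
  have hn2' : (1 : ℝ) ≤ n2 := by exact_mod_cast hn2
  have hgS : ∀ x, g x ≤ S := fun x => hS ▸ le_ciSup hbA x
  have hgI : ∀ x, I ≤ g x := fun x => hI ▸ ciInf_le hbB x
  obtain ⟨hI1, hI2⟩ := hIn
  obtain ⟨hS1, hS2⟩ := hSn
  obtain ⟨S0, hS0a, hS0b⟩ : ∃ S0, max S (-(4 * (n2 : ℝ)) + 2) < S0 ∧ S0 < -(4 * (n2 : ℝ)) + 4 :=
    exists_between (max_lt hS2 (by linarith))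
  obtain ⟨I0, hI0a, hI0b⟩ : ∃ I0, -(4 * (n1 : ℝ)) < I0 ∧ I0 < min I (-(4 * (n1 : ℝ)) + 2) :=
    exists_between (lt_min hI1 (by linarith))
  have hS0c := max_lt_iff.mp hS0a
  have hI0c := lt_min_iff.mp hI0b
  obtain ⟨hup, hup'⟩ := eventually_le_of_stable hd hu (-(4 * (n2 : ℝ)) + 2) S0 hS0c.2
    (-(4 * (n2 : ℝ)) + 4) hS0b (fun x => (hgS x).trans hS0c.1.le)
    (fun y hy => (zetaR_continuousAt y (by linarith [hy.2])).continuousWithinAt)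
    (fun y hy => zetaR_neg n2 hn2 y hy.1 hy.2)
    (fun T => by
      obtain ⟨A, hA⟩ := zetaR_bddAbove S0
      exact ⟨A, fun t x ht _ hS => hA _ hS (hult t x ht)⟩)
  obtain ⟨hlo, hlo'⟩ := eventually_le_of_stable hd (neg_solution hu) (4 * (n1 : ℝ) - 2) (-I0)
    (by linarith) (4 * (n1 : ℝ)) (by linarith) (fun x => by linarith [hgI x])
    (fun y hy => by
      have h1 := zetaR_continuousAt (-y) (by linarith [hy.1])
      exact (ContinuousAt.comp (f := fun y : ℝ => -y) h1 continuous_neg.continuousAt).neg.continuousWithinAt)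
    (fun y hy => by
      have := zetaR_pos n1 hn1 (-y) (by linarith [hy.2]) (by linarith [hy.1])
      linarith)
    (fun T => by
      obtain ⟨B, hB⟩ := hu.2.2.1 T ENNReal.ofReal_lt_top
      have hc : ContinuousOn zetaR (Set.Icc (-B) I0) := fun y hy =>
        (zetaR_continuousAt y (by linarith [hy.2])).continuousWithinAt
      obtain ⟨A, hA⟩ := isCompact_Icc.bddBelow_image hc
      refine ⟨-A, fun t x ht hT hy => ?_⟩
      have h1 := hB t x ht hT
      have h2 : A ≤ zetaR (u t x) := hA ⟨u t x, ⟨(abs_le.mp h1).1, by linarith⟩, rfl⟩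
      simp only [neg_neg]
      linarith)
  intro x
  have hbdA : Filter.IsBoundedUnder (· ≤ ·) Filter.atTop (fun t => u t x) :=
    Filter.isBoundedUnder_of_eventually_le (a := S0)
      ((Filter.eventually_ge_atTop 0).mono fun t ht => hup t x ht)
  have hbdB : Filter.IsBoundedUnder (· ≥ ·) Filter.atTop (fun t => u t x) :=
    Filter.isBoundedUnder_of_eventually_ge (a := I0)
      ((Filter.eventually_ge_atTop 0).mono fun t ht => by linarith [hlo t x ht])
  refine ⟨?_, Filter.liminf_le_limsup hbdA hbdB, ?_⟩
  · apply le_of_forall_lt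
    intro η hη
    obtain ⟨η', h1, h2⟩ := exists_between hη
    refine h1.trans_le (Filter.le_liminf_of_le hbdA.isCoboundedUnder_ge ?_)
    filter_upwards [hlo' (-η') (by linarith) x] with t ht
    linarith
  · apply le_of_forall_gt
    intro η hη
    obtain ⟨η', h1, h2⟩ := exists_between hη
    refine lt_of_le_of_lt (Filter.limsup_le_of_le hbdB.isCoboundedUnder_le ?_) h2
    exact hup' η' h1 x
end
end

section
/- Let d ≥ 1, T ∈ (0,∞), and let u : [0,T) × ℝ^d → ℝ be a real-valued bounded classical solution of the focusing equation ∂_t u = Δu − ζ(u) with bounded continuous real-valued initial datum g, such that −2 < u(t,x) < 1 for all (t,x) ∈ [0,T) × ℝ^d. Set I = inf_x g(x) and assume −2 < I < 1 (so that ζ(I) < 0). Then u(t,x) ≥ I − ζ(I)·t for all (t,x), and consequently T ≤ (1 − I)/(−ζ(I)); in particular no such solution can be global in time. -/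
open MeasureTheory
open scoped ENNReal

noncomputable section

open Set Filter Topology

/-- The weight `φ(t) = (1 - e^{-t}) / (1 + e^{-t})^3`. -/
def phiW (t : ℝ) : ℝ := (1 - Real.exp (-t)) / (1 + Real.exp (-t)) ^ 3

lemma phiW_cont : Continuous phiW := by
  unfold phiW
  refine Continuous.div (by fun_prop) (by fun_prop) (fun t => ?_)
  have := Real.exp_pos (-t)
  positivity

lemma phiW_pos {t : ℝ} (ht : 0 < t) : 0 < phiW t := by
  unfold phiW
  have h1 := Real.exp_pos (-t)
  have h2 : Real.exp (-t) < 1 := by rw [Real.exp_lt_one_iff]; linarith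
  have : 0 < 1 - Real.exp (-t) := by linarith
  positivity

lemma phiW_le_one {t : ℝ} : phiW t ≤ 1 := by
  unfold phiW
  have h1 := Real.exp_pos (-t)
  rw [div_le_one (by positivity)]
  have : 1 ≤ (1 + Real.exp (-t)) ^ 3 := one_le_pow₀ (by linarith)
  linarith

lemma phiW_mono {s t : ℝ} (hs : 0 < s) (hst : s ≤ t) : phiW s ≤ phiW t := by
  unfold phiW
  have h1 := Real.exp_pos (-t)
  have h2 : Real.exp (-t) ≤ Real.exp (-s) := Real.exp_le_exp.2 (by linarith)
  have h3 : Real.exp (-s) < 1 := by rw [Real.exp_lt_one_iff]; linarith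
  gcongr
  linarith

/-- The function whose Mellin transform is `η(s) Γ(s+2)`. -/
def FW (t : ℝ) : ℝ := Real.exp (-t) * phiW t

lemma FW_hasSum {t : ℝ} (ht : 0 < t) :
    HasSum (fun n : ℕ => (-(-1 : ℂ) ^ n * (n : ℂ) ^ 2) * ((Real.exp (-(n : ℝ) * t) : ℝ) : ℂ))
      ((FW t : ℝ) : ℂ) := by
  set y := Real.exp (-t) with hy
  have hy0 : 0 < y := Real.exp_pos _
  have hy1 : y < 1 := by rw [hy, Real.exp_lt_one_iff]; linarith
  have hr : ‖-y‖ < 1 := by rw [norm_neg, Real.norm_of_nonneg hy0.le]; exact hy1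
  have h2 := hasSum_choose_mul_geometric_of_norm_lt_one 2 hr
  have h1 := hasSum_choose_mul_geometric_of_norm_lt_one 1 hr
  have h0 := hasSum_choose_mul_geometric_of_norm_lt_one 0 hr
  have h := ((h2.mul_left (-2)).add ((h1.mul_left 3))).sub h0
  have h' : HasSum (fun n : ℕ => (-(-1 : ℝ) ^ n * (n : ℝ) ^ 2) * Real.exp (-(n : ℝ) * t)) (FW t) := by
    convert! h using 1
    · ext n
      have e : Real.exp (-(n : ℝ) * t) = y ^ n := by
        rw [hy, ← Real.exp_nat_mul]; ring_nf
      have c2 : (((n + 2).choose 2 : ℕ) : ℝ) = (n + 2) * (n + 1) / 2 := by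
        rw [Nat.cast_choose_two]; push_cast; ring
      rw [e, c2, neg_pow y]
      simp
      ring
    · unfold FW phiW
      rw [← hy, sub_neg_eq_add]
      have : 1 + y ≠ 0 := by positivity
      field_simp
      ring
  have := (Complex.hasSum_ofReal).2 h'
  convert this using 2 with n
  push_cast
  ring

lemma eta_hasSum {s : ℂ} (hs : 1 < s.re) :
    HasSum (fun n : ℕ => -(-1 : ℂ) ^ n * (1 / (n : ℂ) ^ s))
      ((1 - 2 ^ (1 - s)) * riemannZeta s) := by
  have hs0 : s ≠ 0 := by rintro rfl; simp at hs; linarith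
  have h1 : HasSum (fun n : ℕ => 1 / (n : ℂ) ^ s) (riemannZeta s) := by
    rw [zeta_eq_tsum_one_div_nat_cpow hs]
    exact (Complex.summable_one_div_nat_cpow.2 hs).hasSum
  have h2 : HasSum (fun n : ℕ => if Even n then 2 * (1 / (n : ℂ) ^ s) else 0)
      (2 ^ (1 - s) * riemannZeta s) := by
    have hinj : Function.Injective (fun n : ℕ => 2 * n) := fun a b h => by simpa using h
    rw [← hinj.hasSum_iff]
    · convert! h1.mul_left ((2 : ℂ) ^ (1 - s)) using 1
      ext n
      simp only [Function.comp, even_two_mul, if_true]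
      rw [Nat.cast_mul, Complex.natCast_mul_natCast_cpow, Complex.cpow_sub _ _ two_ne_zero,
        Complex.cpow_one]
      push_cast
      ring
    · intro n hn
      rw [if_neg]
      rintro ⟨k, rfl⟩
      exact hn ⟨k, by simp; ring⟩
  convert! h1.sub h2 using 1
  · ext n
    split_ifs with h
    · rw [h.neg_one_pow]; ring
    · rw [(Nat.not_even_iff_odd.1 h).neg_one_pow]; ring
  · ring

lemma mellin_FW {s : ℂ} (hs : 1 < s.re) :
    mellin (fun t => ((FW t : ℝ) : ℂ)) (s + 2)
      = (1 - 2 ^ (1 - s)) * riemannZeta s * Complex.Gamma (s + 2) := by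
  have h := hasSum_mellin (a := fun n : ℕ => -(-1 : ℂ) ^ n * (n : ℂ) ^ 2) (p := fun n : ℕ => (n : ℝ))
    (F := fun t => ((FW t : ℝ) : ℂ)) (s := s + 2) ?_ ?_ ?_ ?_
  · refine h.unique ?_
    convert! (eta_hasSum hs).mul_right (Complex.Gamma (s + 2)) using 1
    ext n
    rcases Nat.eq_zero_or_pos n with rfl | hn
    · have hs0 : s ≠ 0 := by rintro rfl; simp at hs; linarith
      simp [hs0]
    · have : (n : ℂ) ≠ 0 := by exact_mod_cast hn.ne'
      simp only [Complex.ofReal_natCast]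
      rw [Complex.cpow_add _ _ this, Complex.cpow_ofNat]
      field_simp
  · intro n
    rcases Nat.eq_zero_or_pos n with rfl | hn
    · left; simp
    · right; exact_mod_cast hn
  · simp; linarith
  · intro t ht
    exact FW_hasSum ht
  · have : Summable (fun n : ℕ => 1 / (n : ℝ) ^ s.re) := Real.summable_one_div_nat_rpow.2 hs
    refine this.congr fun n => ?_
    rcases Nat.eq_zero_or_pos n with rfl | hn
    · simp; rw [Real.zero_rpow (by linarith)]
    · have hn' : (0 : ℝ) < n := by exact_mod_cast hn
      simp only [norm_mul, norm_neg, norm_pow, norm_one, one_pow, one_mul, Complex.norm_natCast,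
        Complex.add_re, Complex.re_ofNat]
      rw [Real.rpow_add hn', Real.rpow_ofNat]
      field_simp

lemma mellin_FW_diff {w : ℂ} (hw : 0 < w.re) :
    DifferentiableAt ℂ (mellin (fun t => ((FW t : ℝ) : ℂ))) w := by
  have hc : Continuous FW := by unfold FW; exact Continuous.mul (by fun_prop) phiW_cont
  have hb : ∀ t, 0 < t → ‖((FW t : ℝ) : ℂ)‖ ≤ Real.exp (-t) := by
    intro t ht
    rw [Complex.norm_real, Real.norm_of_nonneg]
    · unfold FW
      exact mul_le_of_le_one_right (Real.exp_pos _).le phiW_le_one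
    · exact mul_nonneg (Real.exp_pos _).le (phiW_pos ht).le
  refine mellin_differentiableAt_of_isBigO_rpow_exp (a := 1) (b := 0) one_pos ?_ ?_ ?_ hw
  · exact (Complex.continuous_ofReal.comp hc).locallyIntegrable.locallyIntegrableOn _
  · refine Asymptotics.IsBigO.of_bound 1 ?_
    filter_upwards [eventually_gt_atTop 0] with t ht
    simpa using hb t ht
  · refine Asymptotics.IsBigO.of_bound 1 ?_
    filter_upwards [self_mem_nhdsWithin] with t ht
    have ht : 0 < t := ht
    have := hb t ht
    have h2 : Real.exp (-t) ≤ 1 := by rw [Real.exp_le_one_iff]; linarith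
    simp at this ⊢
    linarith

lemma mellin_FW_cont {s : ℂ} (hs : -2 < s.re) (hs1 : s ≠ 1) :
    mellin (fun t => ((FW t : ℝ) : ℂ)) (s + 2)
      = (1 - 2 ^ (1 - s)) * riemannZeta s * Complex.Gamma (s + 2) := by
  set G : ℂ → ℂ := Function.update (fun s => (s - 1) * riemannZeta s) 1 1 with hG
  have hGd : Differentiable ℂ G := by
    rw [← differentiableOn_univ,
      ← Complex.differentiableOn_compl_singleton_and_continuousAt_iff (c := 1) univ_mem]
    refine ⟨?_, ?_⟩
    · intro z hz
      have hz1 : z ≠ 1 := by simpa using hz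
      have : DifferentiableAt ℂ (fun s => (s - 1) * riemannZeta s) z :=
        (by fun_prop : DifferentiableAt ℂ (fun s : ℂ => s - 1) z).mul
          (differentiableAt_riemannZeta hz1)
      refine (this.congr_of_eventuallyEq ?_).differentiableWithinAt
      filter_upwards [isOpen_compl_singleton.mem_nhds hz1] with x hx
      exact Function.update_of_ne hx _ _
    · rw [hG, continuousAt_update_same]
      exact riemannZeta_residue_one
  have hopen : IsOpen {z : ℂ | -2 < z.re} := isOpen_lt continuous_const Complex.continuous_re
  have key : EqOn (fun z => (z - 1) * mellin (fun t => ((FW t : ℝ) : ℂ)) (z + 2))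
      (fun z => (1 - 2 ^ (1 - z)) * G z * Complex.Gamma (z + 2)) {z : ℂ | -2 < z.re} := by
    refine AnalyticOnNhd.eqOn_of_preconnected_of_eventuallyEq (𝕜 := ℂ) (z₀ := 2) ?_ ?_ ?_ ?_ ?_
    · refine DifferentiableOn.analyticOnNhd (fun z hz => ?_) hopen
      have hz : -2 < z.re := hz
      have hd := mellin_FW_diff (w := z + 2) (by simp; linarith)
      have : DifferentiableAt ℂ (fun z => mellin (fun t => ((FW t : ℝ) : ℂ)) (z + 2)) z :=
        DifferentiableAt.comp (g := mellin (fun t => ((FW t : ℝ) : ℂ))) (f := fun z => z + 2) z hd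
          (by fun_prop)
      exact (DifferentiableAt.mul (by fun_prop) this).differentiableWithinAt
    · refine DifferentiableOn.analyticOnNhd (fun z hz => ?_) hopen
      have hz : -2 < z.re := hz
      have hd : DifferentiableAt ℂ Complex.Gamma (z + 2) := by
        refine Complex.differentiableAt_Gamma _ fun m hm => ?_
        have := congrArg Complex.re hm
        simp at this
        have h0 : (0 : ℝ) ≤ m := Nat.cast_nonneg m
        linarith
      have h2 : DifferentiableAt ℂ (fun z => Complex.Gamma (z + 2)) z := hd.comp z (by fun_prop)
      have h3 : DifferentiableAt ℂ (fun z : ℂ => (2 : ℂ) ^ (1 - z)) z :=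
        DifferentiableAt.const_cpow (by fun_prop) (Or.inl two_ne_zero)
      exact ((((differentiableAt_const _).sub h3).mul (hGd z)).mul h2).differentiableWithinAt
    · exact (convex_halfSpace_re_gt (-2)).isPreconnected
    · simp
    · have : {z : ℂ | 1 < z.re} ∈ 𝓝 (2 : ℂ) :=
        (isOpen_lt continuous_const Complex.continuous_re).mem_nhds (by simp)
      filter_upwards [this] with z hz
      have hz : 1 < z.re := hz
      have hz1 : z ≠ 1 := by rintro rfl; simp at hz
      rw [mellin_FW hz, hG, Function.update_of_ne hz1]
      ring
  have h := key hs
  simp only at h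
  rw [hG, Function.update_of_ne hs1] at h
  have : s - 1 ≠ 0 := sub_ne_zero.2 hs1
  apply mul_left_cancel₀ this
  rw [h]; ring

lemma zeta_formula {s : ℝ} (hs : -2 < s) (hs1 : s < 1) :
    (2 ^ (1 - s) - 1) * (-zetaR s) * Real.Gamma (s + 2)
      = ∫ t in Ioi (0 : ℝ), t ^ (s + 1) * FW t := by
  have h := mellin_FW_cont (s := (s : ℂ)) (by simpa using hs)
    (by intro h; have : s = 1 := by exact_mod_cast h
        linarith)
  have e1 : mellin (fun t => ((FW t : ℝ) : ℂ)) ((s : ℂ) + 2)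
      = ((∫ t in Ioi (0 : ℝ), t ^ (s + 1) * FW t : ℝ) : ℂ) := by
    rw [mellin, ← integral_complex_ofReal]
    refine setIntegral_congr_fun measurableSet_Ioi fun t ht => ?_
    have ht : 0 < t := ht
    simp only [smul_eq_mul]
    rw [Complex.ofReal_mul, Complex.ofReal_cpow ht.le]
    congr 2
    push_cast; ring
  have e2 : (1 - (2 : ℂ) ^ (1 - (s : ℂ))) = ((1 - 2 ^ (1 - s) : ℝ) : ℂ) := by
    rw [Complex.ofReal_sub, Complex.ofReal_cpow (by norm_num)]
    push_cast; rfl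
  have e3 : Complex.Gamma ((s : ℂ) + 2) = ((Real.Gamma (s + 2) : ℝ) : ℂ) := by
    rw [← Complex.Gamma_ofReal]; push_cast; rfl
  rw [e1, e2, e3] at h
  have h' := congrArg Complex.re h
  rw [Complex.ofReal_re, Complex.re_mul_ofReal, Complex.re_ofReal_mul] at h'
  rw [h', zetaR]; ring

lemma int_base {s : ℝ} (hs : -2 < s) :
    IntegrableOn (fun t : ℝ => Real.exp (-t) * t ^ (s + 1)) (Ioi 0) := by
  have := Real.GammaIntegral_convergent (s := s + 2) (by linarith)
  convert this using 3
  ring_nf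

lemma int_base_eq {s : ℝ} (hs : -2 < s) :
    ∫ t in Ioi (0 : ℝ), Real.exp (-t) * t ^ (s + 1) = Real.Gamma (s + 2) := by
  rw [Real.Gamma_eq_integral (by linarith)]
  congr 1; ext t; ring_nf

lemma int_FW {s : ℝ} (hs : -2 < s) :
    IntegrableOn (fun t : ℝ => t ^ (s + 1) * FW t) (Ioi 0) := by
  have h := int_base hs
  have h2 := Integrable.bdd_mul (c := 1) h (phiW_cont.aestronglyMeasurable) (by
    refine (ae_restrict_iff' measurableSet_Ioi).2 (Eventually.of_forall fun t ht => ?_)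
    rw [Real.norm_of_nonneg (phiW_pos ht).le]
    exact phiW_le_one)
  refine h2.congr (Eventually.of_forall fun t => ?_)
  simp only [FW]; ring

lemma two_pow_pos {s : ℝ} (hs : s < 1) : 0 < (2 : ℝ) ^ (1 - s) - 1 := by
  have : 1 < (2 : ℝ) ^ (1 - s) := Real.one_lt_rpow (by norm_num) (by linarith)
  linarith

lemma zetaR_neg_s8 {s : ℝ} (hs : -2 < s) (hs1 : s < 1) : zetaR s < 0 := by
  have h := zeta_formula hs hs1
  have hpos : 0 < ∫ t in Ioi (0 : ℝ), t ^ (s + 1) * FW t := by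
    rw [setIntegral_pos_iff_support_of_nonneg_ae _ (int_FW hs)]
    · have : Ioi (0 : ℝ) ⊆ Function.support (fun t : ℝ => t ^ (s + 1) * FW t) ∩ Ioi 0 := by
        intro t ht
        refine ⟨?_, ht⟩
        have := phiW_pos ht
        have ht : 0 < t := ht
        have : 0 < t ^ (s + 1) * FW t := by unfold FW; positivity
        exact this.ne'
      exact lt_of_lt_of_le (by simp) (measure_mono this)
    · refine (ae_restrict_iff' measurableSet_Ioi).2 (Eventually.of_forall fun t ht => ?_)
      have := phiW_pos ht
      have ht : 0 < t := ht
      show 0 ≤ t ^ (s + 1) * FW t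
      unfold FW; positivity
  rw [← h] at hpos
  have hG : 0 < Real.Gamma (s + 2) := Real.Gamma_pos_of_pos (by linarith)
  have := two_pow_pos hs1
  have h3 := (pos_iff_pos_of_mul_pos hpos).2 hG
  have h4 := (pos_iff_pos_of_mul_pos h3).1 this
  linarith

lemma N_mono {a b : ℝ} (ha : -2 < a) (hab : a < b) :
    (∫ t in Ioi (0 : ℝ), t ^ (a + 1) * FW t) / Real.Gamma (a + 2)
      ≤ (∫ t in Ioi (0 : ℝ), t ^ (b + 1) * FW t) / Real.Gamma (b + 2) := by
  have hb : -2 < b := ha.trans hab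
  have hA : 0 < Real.Gamma (a + 2) := Real.Gamma_pos_of_pos (by linarith)
  have hB : 0 < Real.Gamma (b + 2) := Real.Gamma_pos_of_pos (by linarith)
  have hba : 0 < b - a := by linarith
  set c : ℝ := (Real.Gamma (b + 2) / Real.Gamma (a + 2)) ^ (1 / (b - a)) with hc
  have hc0 : 0 < c := by positivity
  have hcp : c ^ (b - a) = Real.Gamma (b + 2) / Real.Gamma (a + 2) := by
    rw [hc, ← Real.rpow_mul (by positivity), one_div_mul_cancel hba.ne', Real.rpow_one]
  have key : 0 ≤ ∫ t in Ioi (0 : ℝ),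
      ((t ^ (b + 1) * FW t) / Real.Gamma (b + 2) - (t ^ (a + 1) * FW t) / Real.Gamma (a + 2)
        - ((Real.exp (-t) * t ^ (b + 1)) * (phiW c / Real.Gamma (b + 2))
          - (Real.exp (-t) * t ^ (a + 1)) * (phiW c / Real.Gamma (a + 2)))) := by
    refine setIntegral_nonneg measurableSet_Ioi fun t ht => ?_
    have ht : 0 < t := ht
    have e : t ^ (b + 1) = t ^ (a + 1) * t ^ (b - a) := by
      rw [← Real.rpow_add ht]; ring_nf
    have e2 : 1 / Real.Gamma (a + 2) = c ^ (b - a) / Real.Gamma (b + 2) := by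
      rw [hcp]; field_simp
    have e3 : (t ^ (b + 1) * FW t) / Real.Gamma (b + 2) - (t ^ (a + 1) * FW t) / Real.Gamma (a + 2)
        - ((Real.exp (-t) * t ^ (b + 1)) * (phiW c / Real.Gamma (b + 2))
          - (Real.exp (-t) * t ^ (a + 1)) * (phiW c / Real.Gamma (a + 2)))
        = Real.exp (-t) * t ^ (a + 1) / Real.Gamma (b + 2)
          * ((phiW t - phiW c) * (t ^ (b - a) - c ^ (b - a))) := by
      rw [div_eq_mul_one_div (phiW c) (Real.Gamma (a + 2)),
        div_eq_mul_one_div (t ^ (a + 1) * FW t) (Real.Gamma (a + 2)), e2,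
        e, FW]
      ring
    rw [e3]
    refine mul_nonneg (by positivity) ?_
    rcases le_total t c with h | h
    · exact mul_nonneg_of_nonpos_of_nonpos (by linarith [phiW_mono ht h])
        (by linarith [Real.rpow_le_rpow ht.le h hba.le])
    · exact mul_nonneg (by linarith [phiW_mono hc0 h])
        (by linarith [Real.rpow_le_rpow hc0.le h hba.le])
  rw [integral_sub, integral_sub, integral_sub, integral_div, integral_div, integral_mul_const,
    integral_mul_const, int_base_eq ha, int_base_eq hb] at key
  · have z1 : Real.Gamma (b + 2) * (phiW c / Real.Gamma (b + 2)) = phiW c := by field_simp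
    have z2 : Real.Gamma (a + 2) * (phiW c / Real.Gamma (a + 2)) = phiW c := by field_simp
    rw [z1, z2] at key
    linarith
  · exact (int_base hb).mul_const _
  · exact (int_base ha).mul_const _
  · exact (int_FW hb).div_const _
  · exact (int_FW ha).div_const _
  · exact ((int_FW hb).div_const _).sub ((int_FW ha).div_const _)
  · exact ((int_base hb).mul_const _).sub ((int_base ha).mul_const _)

lemma zetaR_anti {a b : ℝ} (ha : -2 < a) (hab : a ≤ b) (hb1 : b < 1) : zetaR b ≤ zetaR a := by
  rcases hab.eq_or_lt with rfl | hab
  · exact le_rfl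
  have hb : -2 < b := ha.trans hab
  have hA : 0 < Real.Gamma (a + 2) := Real.Gamma_pos_of_pos (by linarith)
  have hB : 0 < Real.Gamma (b + 2) := Real.Gamma_pos_of_pos (by linarith)
  have h := N_mono ha hab
  rw [← zeta_formula ha (by linarith), ← zeta_formula hb hb1, mul_div_cancel_right₀ _ hA.ne',
    mul_div_cancel_right₀ _ hB.ne'] at h
  have h1 := two_pow_pos hb1
  have h2 : (2 : ℝ) ^ (1 - b) ≤ 2 ^ (1 - a) :=
    Real.rpow_le_rpow_of_exponent_le (by norm_num) (by linarith)
  have h3 := zetaR_neg_s8 ha (by linarith)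
  have h4 : (2 ^ (1 - b) - 1) * (-zetaR a) ≤ (2 ^ (1 - b) - 1) * (-zetaR b) :=
    le_trans (mul_le_mul_of_nonneg_right (by linarith) (by linarith)) h
  have := le_of_mul_le_mul_left h4 h1
  linarith

lemma second_deriv_nonneg {f f' : ℝ → ℝ} {c : ℝ} (hf : ∀ s, HasDerivAt f (f' s) s)
    (hf' : HasDerivAt f' c 0) (hmin : IsLocalMin f 0) : 0 ≤ c := by
  by_contra hc
  push Not at hc
  have hd : deriv f = f' := funext fun s => (hf s).deriv
  have h0 : f' 0 = 0 := hmin.hasDerivAt_eq_zero (hf 0)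
  have hdn : deriv (fun s => -f s) = fun s => -f' s := funext fun s => (hf s).neg.deriv
  have hmax : IsLocalMin (fun s => -f s) 0 := by
    refine isLocalMin_of_deriv_deriv_pos ?_ ?_ (hf 0).neg.continuousAt
    · rw [hdn, hf'.fun_neg.deriv]; linarith
    · rw [hdn]; simp [h0]
  have hconst : f =ᶠ[𝓝 0] fun _ => f 0 := by
    filter_upwards [hmin, hmax] with s h1 h2
    linarith
  have h1 : f' =ᶠ[𝓝 0] fun _ => (0 : ℝ) := by
    have := hconst.deriv
    rw [hd] at this
    simpa using this
  have h2 := h1.deriv_eq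
  rw [hf'.deriv] at h2
  simp at h2
  linarith

lemma time_deriv_nonpos {h : ℝ → ℝ} {c s : ℝ} (hs : 0 < s) (hh : HasDerivAt h c s)
    (hmin : ∀ τ, 0 ≤ τ → τ ≤ s → h s ≤ h τ) : c ≤ 0 := by
  have hm : IsLocalMinOn h (Icc 0 s) s := by
    filter_upwards [self_mem_nhdsWithin] with τ hτ
    exact hmin τ hτ.1 hτ.2
  have hy : (0 - s) ∈ posTangentConeAt (Icc 0 s) s := by
    apply sub_mem_posTangentConeAt_of_segment_subset
    rw [segment_symm, segment_eq_Icc hs.le]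
  have := hm.hasFDerivWithinAt_nonneg hh.hasFDerivAt.hasFDerivWithinAt hy
  simp at this
  nlinarith

lemma heat_min_principle (d : ℕ) (t' C m : ℝ)
    (w wt : ℝ → EuclideanSpace ℝ (Fin d) → ℝ)
    (wx wxx : ℝ → EuclideanSpace ℝ (Fin d) → Fin d → ℝ)
    (hc : ContinuousOn (fun p : ℝ × EuclideanSpace ℝ (Fin d) => w p.1 p.2)
      {p | 0 ≤ p.1 ∧ p.1 ≤ t'})
    (hC : ∀ t x, 0 ≤ t → t ≤ t' → -C ≤ w t x)
    (hm : ∀ x, m ≤ w 0 x)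
    (ht : ∀ t x, 0 < t → t ≤ t' → HasDerivAt (fun τ => w τ x) (wt t x) t)
    (hx : ∀ t x i, 0 < t → t ≤ t' →
      HasDerivAt (fun s : ℝ => w t (x + s • EuclideanSpace.single i (1:ℝ))) (wx t x i) 0)
    (hxx : ∀ t x i, 0 < t → t ≤ t' →
      HasDerivAt (fun s : ℝ => wx t (x + s • EuclideanSpace.single i (1:ℝ)) i) (wxx t x i) 0)
    (hsup : ∀ t x, 0 < t → t ≤ t' → (∑ i, wxx t x i) ≤ wt t x) :
    ∀ t x, 0 ≤ t → t ≤ t' → m ≤ w t x := by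
  intro t0 x0 ht0 ht0'
  have main : ∀ ε : ℝ, 0 < ε → m ≤ w t0 x0 + ε * (‖x0‖ ^ 2 + (2 * d + 1) * t0) := by
    intro ε hε
    by_contra hlt
    push Not at hlt
    set φ : ℝ × EuclideanSpace ℝ (Fin d) → ℝ :=
      fun p => w p.1 p.2 + ε * (‖p.2‖ ^ 2 + (2 * d + 1) * p.1) with hφ
    set R : ℝ := ‖x0‖ + |m + C| / ε + 1 with hR
    have hRx : ‖x0‖ ≤ R := by
      have : 0 ≤ |m + C| / ε := by positivity
      linarith
    have hR1 : 1 ≤ R := by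
      have : 0 ≤ |m + C| / ε := by positivity
      have := norm_nonneg x0
      linarith
    have hRε : m + C ≤ ε * R ^ 2 := by
      have h1 : |m + C| / ε ≤ R := by have := norm_nonneg x0; linarith
      have h2 : |m + C| ≤ R * ε := (div_le_iff₀ hε).1 h1
      have h3 : R ≤ R ^ 2 := by nlinarith
      have h4 := le_abs_self (m + C)
      nlinarith
    have hK : IsCompact (Icc 0 t' ×ˢ Metric.closedBall (0 : EuclideanSpace ℝ (Fin d)) R) :=
      isCompact_Icc.prod (isCompact_closedBall _ _)
    have hφc : ContinuousOn φ (Icc 0 t' ×ˢ Metric.closedBall (0 : EuclideanSpace ℝ (Fin d)) R) := by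
      refine ContinuousOn.add (hc.mono fun p hp => hp.1) ?_
      fun_prop
    have hmem : (t0, x0) ∈ Icc 0 t' ×ˢ Metric.closedBall (0 : EuclideanSpace ℝ (Fin d)) R :=
      ⟨⟨ht0, ht0'⟩, by simpa using hRx⟩
    obtain ⟨⟨s, y⟩, ⟨⟨hs0, hs1⟩, hy⟩, hmin⟩ := hK.exists_isMinOn ⟨_, hmem⟩ hφc
    simp only at hs0 hs1 hy
    have hlt' : φ (s, y) < m := lt_of_le_of_lt (hmin hmem) hlt
    have hglob : ∀ t x, 0 ≤ t → t ≤ t' → φ (s, y) ≤ φ (t, x) := by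
      intro t x h0 h1
      by_cases hxR : ‖x‖ ≤ R
      · exact hmin (show (t, x) ∈ _ from ⟨⟨h0, h1⟩, by simpa using hxR⟩)
      · push Not at hxR
        refine hlt'.le.trans ?_
        have e1 := hC t x h0 h1
        have e2 : R ^ 2 ≤ ‖x‖ ^ 2 := by gcongr
        have e3 : ε * R ^ 2 ≤ ε * (‖x‖ ^ 2 + (2 * d + 1) * t) := by
          have : 0 ≤ (2 * (d : ℝ) + 1) * t := by positivity
          gcongr; linarith
        simp only [hφ]
        linarith
    have hs : 0 < s := by
      rcases hs0.eq_or_lt with h | h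
      · exfalso
        subst h
        have := hm y
        have h2 : 0 ≤ ε * (‖y‖ ^ 2 + (2 * d + 1) * 0) := by positivity
        simp only [hφ] at hlt'
        linarith
      · exact h
    have htime : wt s y + ε * (2 * d + 1) ≤ 0 := by
      have hd : HasDerivAt (fun τ => φ (τ, y)) (wt s y + ε * (2 * d + 1)) s := by
        have h1 := ht s y hs hs1
        have h2 : HasDerivAt (fun τ : ℝ => ε * (‖y‖ ^ 2 + (2 * d + 1) * τ)) (ε * (2 * d + 1)) s := by
          have := (((hasDerivAt_id s).const_mul (2 * (d : ℝ) + 1)).const_add (‖y‖ ^ 2)).const_mul ε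
          simpa using this
        exact h1.add h2
      exact time_deriv_nonpos hs hd fun τ h0 h1 => hglob τ y h0 (h1.trans hs1)
    have hspace : ∀ i, 0 ≤ wxx s y i + 2 * ε := by
      intro i
      set e := EuclideanSpace.single i (1 : ℝ) with he
      have hn : ∀ σ : ℝ, ‖y + σ • e‖ ^ 2 = ‖y‖ ^ 2 + 2 * σ * inner ℝ y e + σ ^ 2 := by
        intro σ
        rw [norm_add_sq_real, inner_smul_right, norm_smul]
        have : ‖e‖ = 1 := by simp [he]
        rw [this, mul_one, Real.norm_eq_abs, sq_abs]
        ring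
      refine second_deriv_nonneg
        (f := fun σ => w s (y + σ • e) + ε * (2 * σ * inner ℝ y e + σ ^ 2))
        (f' := fun σ => wx s (y + σ • e) i + ε * (2 * inner ℝ y e + 2 * σ)) ?_ ?_ ?_
      · intro σ
        refine HasDerivAt.add ?_ ?_
        · have h1 := hx s (y + σ • e) i hs hs1
          rw [← sub_self σ] at h1
          have h2 := HasDerivAt.comp_sub_const σ σ h1
          convert! h2 using 1
          ext τ
          congr 1
          rw [sub_smul]
          abel
        · have h1 : HasDerivAt (fun σ : ℝ => 2 * σ * inner ℝ y e) (2 * inner ℝ y e) σ := by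
            have := ((hasDerivAt_id σ).const_mul 2).mul_const (inner ℝ y e)
            simpa using this
          have h2 : HasDerivAt (fun σ : ℝ => σ ^ 2) (2 * σ) σ := by
            simpa using hasDerivAt_pow 2 σ
          exact (h1.add h2).const_mul ε
      · refine HasDerivAt.add (hxx s y i hs hs1) ?_
        have := (((hasDerivAt_id (0 : ℝ)).const_mul 2).const_add (2 * inner ℝ y e)).const_mul ε
        simpa [mul_comm] using this
      · refine Eventually.of_forall fun σ => ?_
        have := hglob s (y + σ • e) hs0 hs1
        simp only [hφ, hn] at this
        simp
        linarith
    have hsum : 0 ≤ ∑ i, (wxx s y i + 2 * ε) := Finset.sum_nonneg fun i _ => hspace i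
    rw [Finset.sum_add_distrib] at hsum
    simp at hsum
    have := hsup s y hs hs1
    nlinarith
  have hB : 0 ≤ ‖x0‖ ^ 2 + (2 * (d : ℝ) + 1) * t0 := by positivity
  refine le_of_forall_pos_le_add fun δ hδ => ?_
  have h1 := main (δ / (‖x0‖ ^ 2 + (2 * d + 1) * t0 + 1)) (by positivity)
  have h2 : δ / (‖x0‖ ^ 2 + (2 * d + 1) * t0 + 1) * (‖x0‖ ^ 2 + (2 * d + 1) * t0) ≤ δ := by
    rw [div_mul_eq_mul_div, div_le_iff₀ (by positivity)]
    nlinarith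
  linarith

theorem stmt8 (d : ℕ) (hd : 1 ≤ d) (T : ℝ) (hT : 0 < T)
    (g : EuclideanSpace ℝ (Fin d) → ℝ) (hgc : Continuous g) (hgb : ∃ C, ∀ x, |g x| ≤ C)
    (u : ℝ → EuclideanSpace ℝ (Fin d) → ℝ)
    (hu : IsHeatSolutionR d (fun y => -zetaR y) (ENNReal.ofReal T) g u)
    (hurange : ∀ t x, 0 ≤ t → t < T → -2 < u t x ∧ u t x < 1)
    (I : ℝ) (hI : I = ⨅ x, g x) (hIrange : -2 < I ∧ I < 1) :
    (∀ t x, 0 ≤ t → t < T → I - zetaR I * t ≤ u t x) ∧ T ≤ (1 - I) / (-zetaR I) := by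
  obtain ⟨hcont, hinit, hbdd, ut, ux, uxx, hut, hux, huxx, -, -, heq⟩ := hu
  have hofT : ∀ t : ℝ, t < T → ENNReal.ofReal t < ENNReal.ofReal T := fun t ht =>
    (ENNReal.ofReal_lt_ofReal_iff hT).2 ht
  have hg : ∀ x, I ≤ u 0 x := by
    intro x
    rw [hinit, hI]
    obtain ⟨C, hC⟩ := hgb
    exact ciInf_le ⟨-C, by rintro _ ⟨z, rfl⟩; exact (abs_le.1 (hC z)).1⟩ x
  have hζI := zetaR_neg_s8 hIrange.1 hIrange.2
  have step1 : ∀ t x, 0 ≤ t → t < T → I ≤ u t x := by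
    intro t x h0 h1
    refine heat_min_principle d t 2 I u ut ux uxx ?_ ?_ hg ?_ ?_ ?_ ?_ t x h0 le_rfl
    · exact hcont.mono fun p hp => ⟨hp.1, hofT _ (lt_of_le_of_lt hp.2 h1)⟩
    · exact fun s y hs hs' => (hurange s y hs (by linarith)).1.le
    · exact fun s y hs hs' => hut s y hs (hofT _ (by linarith))
    · exact fun s y i hs hs' => hux s y i hs (hofT _ (by linarith))
    · exact fun s y i hs hs' => huxx s y i hs (hofT _ (by linarith))
    · intro s y hs hs'
      rw [heq s y hs (hofT _ (by linarith))]
      have hr := hurange s y hs.le (by linarith)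
      have := zetaR_neg_s8 hr.1 hr.2
      linarith
  have step2 : ∀ t x, 0 ≤ t → t < T → I - zetaR I * t ≤ u t x := by
    intro t x h0 h1
    have := heat_min_principle d t (2 - zetaR I * t) I (fun s y => u s y + zetaR I * s)
      (fun s y => ut s y + zetaR I) ux uxx ?_ ?_ ?_ ?_ ?_ ?_ ?_ t x h0 le_rfl
    · linarith
    · refine ContinuousOn.add
        (hcont.mono fun p hp => ⟨hp.1, hofT _ (lt_of_le_of_lt hp.2 h1)⟩) ?_
      fun_prop
    · intro s y hs hs'
      have := (hurange s y hs (by linarith)).1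
      nlinarith
    · intro y
      simpa using hg y
    · intro s y hs hs'
      have h2 : HasDerivAt (fun τ : ℝ => zetaR I * τ) (zetaR I) s := by
        simpa using (hasDerivAt_id s).const_mul (zetaR I)
      exact (hut s y hs (hofT _ (by linarith))).add h2
    · exact fun s y i hs hs' => (hux s y i hs (hofT _ (by linarith))).add_const _
    · exact fun s y i hs hs' => huxx s y i hs (hofT _ (by linarith))
    · intro s y hs hs'
      rw [heq s y hs (hofT _ (by linarith))]
      have := zetaR_anti hIrange.1 (step1 s y hs.le (by linarith))
        (hurange s y hs.le (by linarith)).2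
      linarith
  refine ⟨step2, ?_⟩
  refine le_of_forall_lt fun t ht => ?_
  rw [lt_div_iff₀ (by linarith)]
  rcases lt_or_ge t 0 with h | h
  · nlinarith [hIrange.2]
  · have h1 := step2 t 0 h ht
    have h2 := (hurange t 0 h ht).2
    linarith
end
end
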